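/- arXiv:1307.0657 — 2 statements merged into one kernel-verified Lean document; each statement's English description precedes it below -/
import Mathlib

section
/- Let α < 0 and ε ≥ 0. If f : (0,1) → ℝ satisfies |f(x) + (1-x)^α f(y/(1-x)) - f(y) - (1-y)^α f(x/(1-y))| ≤ ε for all (x,y) with x, y, x+y ∈ (0,1), then there exist a, b ∈ ℝ such that |f(x) - [a x^α + b(1-x)^α - b]| ≤ ε(8 + 6·2^α + 2^{-α})/(2^{1-α} - 1) for all x ∈ (0,1). -/
open Filter Topology

/-- If the cyclic sums of an antisymmetric kernel are bounded by `C * (x + y + z) ^ α` with `α < 0`,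
then they vanish. -/
lemma cyclic_sum_eq_zero_of_abs_le {α C : ℝ} (hα : α < 0) {A : ℝ → ℝ → ℝ}
    (hA : ∀ x y, A y x = -A x y)
    (hC : ∀ x y z : ℝ, 0 < x → 0 < y → 0 < z →
      |A x y + A y z + A z x| ≤ C * (x + y + z) ^ α)
    {x y w : ℝ} (hx : 0 < x) (hy : 0 < y) (hw : 0 < w) :
    A x y + A y w + A w x = 0 := by
  have lim : ∀ c : ℝ, Tendsto (fun z : ℝ => C * (c + z) ^ α) atTop (𝓝 0) := fun c => by
    have h : Tendsto (fun t : ℝ => t ^ α) atTop (𝓝 0) := by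
      simpa using tendsto_rpow_neg_atTop (neg_pos.2 hα)
    simpa using (h.comp (tendsto_atTop_add_const_left atTop c tendsto_id)).const_mul C
  have hlim := ((lim (x + y)).add (lim (y + w))).add (lim (w + x))
  simp only [add_zero] at hlim
  refine abs_nonpos_iff.1 (ge_of_tendsto hlim ?_)
  filter_upwards [eventually_gt_atTop 0] with z hz
  have h₁ := abs_le.1 (hC x y z hx hy hz)
  have h₂ := abs_le.1 (hC y w z hy hw hz)
  have h₃ := abs_le.1 (hC w x z hw hx hz)
  have hzx := hA x z
  have hzy := hA y z
  have hzw := hA w z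
  exact abs_le.2 ⟨by linarith, by linarith⟩

/-- A symmetric, homogeneous approximate cocycle of degree `α < 0` which vanishes on the diagonal
is small. -/
lemma abs_le_of_symm_approx_cocycle {α ε : ℝ} (hα : α < 0) (hε : 0 ≤ ε) {D : ℝ → ℝ → ℝ}
    (hom : ∀ k x y : ℝ, 0 < k → 0 < x → 0 < y → D (k * x) (k * y) = k ^ α * D x y)
    (hD : ∀ x y z : ℝ, 0 < x → 0 < y → 0 < z →
      |D (y + z) x + D z y - D (x + z) y - D z x| ≤ ε * (x + y + z) ^ α)
    (symm : ∀ x y : ℝ, 0 < x → 0 < y → D x y = D y x)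
    (diag : ∀ x : ℝ, 0 < x → D x x = 0) {x y : ℝ} (hx : 0 < x) (hy : 0 < y) :
    (2 - 2 ^ α) * |D x y| ≤ ε * (1 + 2 * 2 ^ α) * (x + y) ^ α := by
  have h₁ := abs_le.1 (hD (2 * x) y y (by positivity) hy hy)
  have h₂ := abs_le.1 (hD y x x hy hx hx)
  have h₃ := abs_le.1 (hD (x + y) y x (by positivity) hy hx)
  have hdouble : (2 * (x + y)) ^ α = 2 ^ α * (x + y) ^ α :=
    Real.mul_rpow (by norm_num) (by positivity)
  have hmono : ε * (x + y + x) ^ α ≤ ε * (x + y) ^ α :=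
    mul_le_mul_of_nonneg_left
      (Real.rpow_le_rpow_of_nonpos (by positivity) (by linarith) hα.le) hε
  have h2xy := hom 2 x y two_pos hx hy
  have hs2 := symm (2 * x) (2 * y) (by positivity) (by positivity)
  have hs1 := symm (2 * x) y (by positivity) hy
  have hs3 := symm (x + y) x (by positivity) hx
  have hs := symm x y hx hy
  have hdx := diag x hx
  have hdy := diag y hy
  have hdxy := diag (x + y) (by positivity)
  rw [show y + y = 2 * y by ring, show 2 * x + y + y = 2 * (x + y) by ring, hdouble] at h₁
  rw [show x + x = 2 * x by ring, show y + x = x + y by ring] at h₂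
  rw [show x + y + y + x = 2 * (x + y) by ring, show y + x = x + y by ring,
    show x + y + x = 2 * x + y by ring, hdouble] at h₃
  have hs2' : (2 : ℝ) ^ α < 1 := Real.rpow_lt_one_of_one_lt_of_neg one_lt_two hα
  rw [← abs_of_pos (show (0 : ℝ) < 2 - 2 ^ α by linarith), ← abs_mul, abs_le]
  constructor <;> linarith

/-- Hyers-Ulam stability of homogeneous cocycles of degree `α < 0`. -/
lemma exists_abs_sub_le_of_approx_cocycle {α ε : ℝ} (hα : α < 0) (hε : 0 ≤ ε) {F : ℝ → ℝ → ℝ}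
    (hom : ∀ k x y : ℝ, 0 < k → 0 < x → 0 < y → F (k * x) (k * y) = k ^ α * F x y)
    (hF : ∀ x y z : ℝ, 0 < x → 0 < y → 0 < z →
      |F (y + z) x + F z y - F (x + z) y - F z x| ≤ ε * (x + y + z) ^ α) :
    ∃ a b : ℝ, ∀ x y : ℝ, 0 < x → 0 < y →
      (2 - 2 ^ α) * |F x y - (a * y ^ α + b * x ^ α - b * (x + y) ^ α)| ≤
        ε * (1 + 2 * 2 ^ α) * (x + y) ^ α := by
  have hs : (2 : ℝ) ^ α < 1 := Real.rpow_lt_one_of_one_lt_of_neg one_lt_two hα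
  have hcyc : ∀ x y z : ℝ, 0 < x → 0 < y → 0 < z →
      (F x y - F y x) + (F y z - F z y) + (F z x - F x z) = 0 := by
    intro x y z hx hy hz
    refine cyclic_sum_eq_zero_of_abs_le (A := fun x y => F x y - F y x) (C := 3 * ε) hα
      (fun _ _ => by ring) ?_ hx hy hz
    intro x y z hx hy hz
    have h₁ := abs_le.1 (hF x y z hx hy hz)
    have h₂ := abs_le.1 (hF y z x hy hz hx)
    have h₃ := abs_le.1 (hF z x y hz hx hy)
    rw [show y + z + x = x + y + z by ring] at h₂
    rw [show z + x + y = x + y + z by ring] at h₃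
    rw [add_comm z x, add_comm y x] at h₂
    rw [add_comm z y] at h₃
    exact abs_le.2 ⟨by linarith, by linarith⟩
  obtain ⟨c, hc⟩ : ∃ c : ℝ, c * (1 - 2 ^ α) = F 2 1 - F 1 2 :=
    ⟨_, div_mul_cancel₀ _ (by linarith)⟩
  have hanti : ∀ x y : ℝ, 0 < x → 0 < y → F x y - c * y ^ α = F y x - c * x ^ α := by
    intro x y hx hy
    have h₁ := hcyc x y (y * 2) hx hy (by positivity)
    have h₂ := hcyc x (2 * y) (2 * x) hx (by positivity) (by positivity)
    have e₁ := hom 2 x y two_pos hx hy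
    have e₂ := hom 2 y x two_pos hy hx
    have e₃ := hom x 1 2 hx one_pos two_pos
    have e₄ := hom x 2 1 hx two_pos one_pos
    have e₅ := hom y 1 2 hy one_pos two_pos
    have e₆ := hom y 2 1 hy two_pos one_pos
    rw [mul_one, mul_comm _ (2 : ℝ)] at e₃ e₄ e₅ e₆
    rw [mul_comm _ (2 : ℝ)] at h₁
    have key : (1 - 2 ^ α) * (F x y - c * y ^ α - (F y x - c * x ^ α)) = 0 := by
      linear_combination h₁ + h₂ - e₅ + e₆ + e₁ - e₂ + e₃ - e₄ + (x ^ α - y ^ α) * hc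
    rcases mul_eq_zero.1 key with h | h <;> linarith
  obtain ⟨b, hb⟩ : ∃ b : ℝ, b * (2 - 2 ^ α) = F 1 1 - c :=
    ⟨_, div_mul_cancel₀ _ (by linarith)⟩
  refine ⟨c + b, b, fun x y hx hy => ?_⟩
  refine abs_le_of_symm_approx_cocycle
    (D := fun x y => F x y - ((c + b) * y ^ α + b * x ^ α - b * (x + y) ^ α)) hα hε
    ?_ ?_ ?_ ?_ hx hy
  · intro k x y hk hx hy
    simp only [← mul_add]
    rw [hom k x y hk hx hy, Real.mul_rpow hk.le hx.le, Real.mul_rpow hk.le hy.le,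
      Real.mul_rpow hk.le (by positivity)]
    ring
  · intro x y z hx hy hz
    refine le_of_eq_of_le (congrArg _ ?_) (hF x y z hx hy hz)
    simp only [show x + z + y = y + z + x by ring, add_comm z]
    ring
  · intro x y hx hy
    simp only [add_comm y x]
    linear_combination hanti x y hx hy
  · intro x hx
    have h := hom x 1 1 hx one_pos one_pos
    rw [mul_one] at h
    simp only [← two_mul]
    rw [Real.mul_rpow two_pos.le hx.le]
    linear_combination h - x ^ α * hb

theorem stmt_11 (α ε : ℝ) (hα : α < 0) (hε : 0 ≤ ε) (f : ℝ → ℝ)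
    (hf : ∀ x y : ℝ, 0 < x → 0 < y → x + y < 1 →
      |f x + (1 - x) ^ α * f (y / (1 - x)) - f y - (1 - y) ^ α * f (x / (1 - y))| ≤ ε) :
    ∃ a b : ℝ, ∀ x : ℝ, x ∈ Set.Ioo (0 : ℝ) 1 →
      |f x - (a * x ^ α + b * (1 - x) ^ α - b)| ≤
        ε * (8 + 6 * 2 ^ α + 2 ^ (-α)) / (2 ^ (1 - α) - 1) := by
  obtain ⟨a, b, hab⟩ := exists_abs_sub_le_of_approx_cocycle
    (F := fun u v => (u + v) ^ α * f (v / (u + v))) hα hε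
    (by
      intro k x y hk hx hy
      simp only [← mul_add]
      rw [Real.mul_rpow hk.le (by positivity), mul_div_mul_left _ _ hk.ne']
      ring)
    (by
      intro x y z hx hy hz
      have ht : 0 < x + y + z := by positivity
      have h := hf (x / (x + y + z)) (y / (x + y + z)) (by positivity) (by positivity)
        (by rw [← add_div, div_lt_one ht]; linarith)
      rw [show 1 - x / (x + y + z) = (y + z) / (x + y + z) by field_simp; ring,
        show 1 - y / (x + y + z) = (x + z) / (x + y + z) by field_simp; ring,
        div_div_div_cancel_right₀ ht.ne', div_div_div_cancel_right₀ ht.ne',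
        Real.div_rpow (by positivity) ht.le, Real.div_rpow (by positivity) ht.le] at h
      have hpos : 0 < (x + y + z) ^ α := Real.rpow_pos_of_pos ht α
      have h' := mul_le_mul_of_nonneg_right h hpos.le
      rw [← abs_of_pos hpos, ← abs_mul, abs_of_pos hpos] at h'
      refine le_of_eq_of_le (congrArg _ ?_) h'
      simp only [show y + z + x = x + y + z by ring, show x + z + y = x + y + z by ring,
        add_comm z]
      field_simp)
  refine ⟨a, b, fun x hx => ?_⟩
  have h := hab (1 - x) x (by linarith [hx.2]) hx.1
  simp only [sub_add_cancel, Real.one_rpow, one_mul, div_one, mul_one] at h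
  have hpos : (0 : ℝ) < 2 ^ α := Real.rpow_pos_of_pos two_pos α
  have hlt : (2 : ℝ) ^ α < 1 := Real.rpow_lt_one_of_one_lt_of_neg one_lt_two hα
  rw [Real.rpow_sub two_pos, Real.rpow_one, Real.rpow_neg two_pos.le]
  generalize (2 : ℝ) ^ α = s at *
  rw [show ε * (8 + 6 * s + s⁻¹) / (2 / s - 1) = ε * (1 + 8 * s + 6 * s ^ 2) / (2 - s) by
    have : 2 - s ≠ 0 := by linarith
    have : 2 / s - 1 ≠ 0 := by
      rw [div_sub_one hpos.ne']
      positivity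
    field_simp
    ring, le_div_iff₀ (by linarith), mul_comm]
  exact h.trans (mul_le_mul_of_nonneg_left (by nlinarith) hε)
end

section
/- Let ε ≥ 0. If f : (0,1) → ℝ satisfies |f(x) + f(y/(1-x)) - f(y) - f(x/(1-y))| ≤ ε for all (x,y) with x, y, x+y ∈ (0,1), then there exist a logarithmic function l : (0,1) → ℝ and c ∈ ℝ such that |f(x) - l(1-x) - c| ≤ 63ε for all x ∈ (0,1). -/
open Filter Topology in
/-- Hyers' theorem for the multiplicative group of positive reals: an approximately logarithmic
function is uniformly close to a logarithmic one. -/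
theorem exists_log_near {k : ℝ → ℝ} {C : ℝ}
    (hk : ∀ s t : ℝ, 0 < s → 0 < t → |k (s * t) - k s - k t| ≤ C) :
    ∃ K : ℝ → ℝ, (∀ s t : ℝ, 0 < s → 0 < t → K (s * t) = K s + K t) ∧
      ∀ s : ℝ, 0 < s → |k s - K s| ≤ C := by
  set a : ℝ → ℕ → ℝ := fun s n => k (s ^ 2 ^ n) / 2 ^ n with ha
  have hstep : ∀ s : ℝ, 0 < s → ∀ n, dist (a s n) (a s (n + 1)) ≤ C / 2 / 2 ^ n := by
    intro s hs n
    have h := hk (s ^ 2 ^ n) (s ^ 2 ^ n) (by positivity) (by positivity)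
    have hsq : s ^ 2 ^ n * s ^ 2 ^ n = s ^ 2 ^ (n + 1) := by rw [← pow_add, pow_succ, mul_two]
    rw [hsq] at h
    have hdiff : a s n - a s (n + 1) =
        -((k (s ^ 2 ^ (n + 1)) - k (s ^ 2 ^ n) - k (s ^ 2 ^ n)) / (2 * 2 ^ n)) := by
      simp only [ha, pow_succ (2 : ℝ) n]
      field_simp
      ring
    rw [Real.dist_eq, hdiff, abs_neg, abs_div, abs_of_pos (by positivity : (0 : ℝ) < 2 * 2 ^ n),
      div_div]
    gcongr
  have hlim : ∀ s : ℝ, ∃ L, 0 < s → Tendsto (a s) atTop (𝓝 L) := by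
    intro s
    by_cases hs : 0 < s
    · obtain ⟨L, hL⟩ := cauchySeq_tendsto_of_complete (cauchySeq_of_le_geometric_two (hstep s hs))
      exact ⟨L, fun _ => hL⟩
    · exact ⟨0, fun h => absurd h hs⟩
  choose K hK using hlim
  refine ⟨K, fun s t hs ht => ?_, fun s hs => ?_⟩
  · have h := ((hK _ (mul_pos hs ht)).sub (hK s hs)).sub (hK t ht)
    have hzero : Tendsto (fun n => a (s * t) n - a s n - a t n) atTop (𝓝 0) := by
      have hgeom : Tendsto (fun n : ℕ => C * (1 / 2 : ℝ) ^ n) atTop (𝓝 0) := by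
        simpa using (tendsto_pow_atTop_nhds_zero_of_lt_one (r := (1 / 2 : ℝ))
          (by norm_num) (by norm_num)).const_mul C
      refine squeeze_zero_norm (fun n => ?_) hgeom
      have hn := hk (s ^ 2 ^ n) (t ^ 2 ^ n) (by positivity) (by positivity)
      rw [← mul_pow] at hn
      have hdiff : a (s * t) n - a s n - a t n =
          (k ((s * t) ^ 2 ^ n) - k (s ^ 2 ^ n) - k (t ^ 2 ^ n)) / 2 ^ n := by
        simp only [ha]
        ring
      rw [Real.norm_eq_abs, hdiff, abs_div, abs_of_pos (by positivity : (0 : ℝ) < 2 ^ n),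
        one_div, inv_pow, ← div_eq_mul_inv]
      gcongr
    linarith [tendsto_nhds_unique h hzero]
  · have h := dist_le_of_le_geometric_two_of_tendsto₀ (hstep s hs) (hK s hs)
    simpa [ha, Real.dist_eq] using h

/-- A function of pairs of positive reals that is approximately a symmetric cocycle, constant on the
diagonal and invariant under doubling, is approximately constant. -/
theorem abs_sub_le_of_approx_cocycle {φ : ℝ → ℝ → ℝ} {ε δ c : ℝ}
    (hφ : ∀ p q r : ℝ, 0 < p → 0 < q → 0 < r →
      |φ p (q + r) + φ q r - φ q (p + r) - φ p r| ≤ ε)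
    (hsymm : ∀ p q : ℝ, 0 < p → 0 < q → |φ p q - φ q p| ≤ δ)
    (hdiag : ∀ p : ℝ, 0 < p → φ p p = c)
    (hdouble : ∀ p q : ℝ, 0 < p → 0 < q → φ (p + p) (q + q) = φ p q)
    {p q : ℝ} (hp : 0 < p) (hq : 0 < q) : |φ q p - c| ≤ 3 * ε + 3 * δ := by
  have h₁ := hφ (p + p) q q (by positivity) hq hq
  have h₂ := hφ q p p hq hp hp
  have h₃ := hφ (p + q) q p (by positivity) hq hp
  have s₁ := hsymm (p + p) q (by positivity) hq
  have s₂ := hsymm (p + q) p (by positivity) hp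
  have s₃ := hsymm p q hp hq
  rw [hdouble p q hp hq, hdiag q hq] at h₁
  rw [hdiag p hp, add_comm q p] at h₂
  rw [add_comm q p, hdiag (p + q) (by positivity), show p + q + p = p + p + q by ring] at h₃
  rw [abs_le] at *
  constructor <;> linarith [h₁.1, h₁.2, h₂.1, h₂.2, h₃.1, h₃.2, s₁.1, s₁.2, s₂.1, s₂.2, s₃.1, s₃.2]

theorem stmt_12 (ε : ℝ) (hε : 0 ≤ ε) (f : ℝ → ℝ)
    (hf : ∀ x y : ℝ, 0 < x → 0 < y → x + y < 1 →
      |f x + f (y / (1 - x)) - f y - f (x / (1 - y))| ≤ ε) :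
    ∃ (l : ℝ → ℝ) (c : ℝ),
      (∀ x y : ℝ, x ∈ Set.Ioo (0 : ℝ) 1 → y ∈ Set.Ioo (0 : ℝ) 1 →
        x * y ∈ Set.Ioo (0 : ℝ) 1 → l (x * y) = l x + l y) ∧
      ∀ x : ℝ, x ∈ Set.Ioo (0 : ℝ) 1 → |f x - l (1 - x) - c| ≤ 63 * ε := by
  set φ : ℝ → ℝ → ℝ := fun p r => f (p / (p + r)) with hφ_def
  have hφ : ∀ p q r : ℝ, 0 < p → 0 < q → 0 < r →
      |φ p (q + r) + φ q r - φ q (p + r) - φ p r| ≤ ε := by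
    intro p q r hp hq hr
    have h := hf (p / (p + (q + r))) (q / (q + (p + r))) (by positivity) (by positivity) (by
      rw [show q + (p + r) = p + (q + r) by ring, ← add_div, div_lt_one (by positivity)]
      linarith)
    rwa [show q / (q + (p + r)) / (1 - p / (p + (q + r))) = q / (q + r) by
        rw [one_sub_div (by positivity), add_sub_cancel_left]; field_simp; ring,
      show p / (p + (q + r)) / (1 - q / (q + (p + r))) = p / (p + r) by
        rw [one_sub_div (by positivity), add_sub_cancel_left]; field_simp; ring] at h
  have hscale : ∀ t p r : ℝ, 0 < t → φ (t * p) (t * r) = φ p r := by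
    intro t p r ht
    simp only [hφ_def, ← mul_add, mul_div_mul_left _ _ ht.ne']
  obtain ⟨K, hK_mul, hK_near⟩ := exists_log_near (k := fun s => φ s 1 - φ 1 s) (C := 3 * ε) (by
    intro s t hs ht
    have hst := mul_pos hs ht
    have h₁ := hφ (s * t) t 1 hst ht one_pos
    have h₂ := hφ t 1 (s * t) ht one_pos hst
    have h₃ := hφ 1 (s * t) t one_pos hst ht
    have e₁ : φ (s * t) t = φ s 1 := by simpa [mul_comm] using hscale t s 1 ht
    have e₂ : φ t (s * t) = φ 1 s := by simpa [mul_comm] using hscale t 1 s ht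
    rw [add_comm (1 : ℝ) (s * t)] at h₂
    rw [add_comm (1 : ℝ) t, add_comm (s * t) t] at h₃
    rw [e₂] at h₂
    rw [e₁] at h₃
    rw [abs_le] at *
    constructor <;> linarith [h₁.1, h₁.2, h₂.1, h₂.2, h₃.1, h₃.2])
  have hK_one : K 1 = 0 := by
    have := hK_mul 1 1 one_pos one_pos
    rw [one_mul] at this
    linarith
  have hK_two : ∀ p : ℝ, 0 < p → K (p + p) = K 2 + K p := fun p hp => by
    rw [← two_mul, hK_mul 2 p two_pos hp]
  have hbound : ∀ p q : ℝ, 0 < p → 0 < q →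
      |(φ q p - K (q + p) + K p) - (f (1 / 2) - K 2)| ≤ 3 * ε + 3 * (3 * ε) := by
    intro p q hp hq
    refine abs_sub_le_of_approx_cocycle (φ := fun p r => φ p r - K (p + r) + K r)
      ?_ ?_ ?_ ?_ hp hq
    · intro p q r hp hq hr
      convert hφ p q r hp hq hr using 2
      simp only [show q + (p + r) = p + (q + r) by ring]
      ring
    · intro p q hp hq
      have h := hK_near (p / q) (by positivity)
      have e₁ : φ (p / q) 1 = φ p q := by
        rw [← hscale q (p / q) 1 hq, mul_one, mul_div_cancel₀ p hq.ne']
      have e₂ : φ 1 (p / q) = φ q p := by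
        rw [← hscale q 1 (p / q) hq, mul_one, mul_div_cancel₀ p hq.ne']
      have e₃ : K p = K (p / q) + K q := by
        rw [← hK_mul _ _ (by positivity) hq, div_mul_cancel₀ p hq.ne']
      simp only [e₁, e₂] at h
      convert h using 2
      simp only [add_comm q p, e₃]
      ring
    · intro p hp
      have e : p / (p + p) = 1 / 2 := by field_simp; ring
      simp only [hφ_def, e, hK_two p hp]
      ring
    · intro p q hp hq
      have e₁ : φ (p + p) (q + q) = φ p q := by
        rw [← two_mul, ← two_mul, hscale 2 p q two_pos]
      have e₂ : K (p + p + (q + q)) = K 2 + K (p + q) := by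
        rw [← hK_two (p + q) (by positivity)]
        ring_nf
      simp only [e₁, e₂, hK_two q hq]
      ring
  refine ⟨fun x => -K x, f (1 / 2) - K 2, fun x y hx hy _ => ?_, fun x hx => ?_⟩
  · simp only [hK_mul x y hx.1 hy.1]
    ring
  · have h := hbound (1 - x) x (by linarith [hx.2]) hx.1
    simp only [hφ_def, add_sub_cancel, div_one, hK_one, sub_zero] at h
    rw [sub_neg_eq_add]
    linarith
end
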